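/- Let Θ be a countable model with prior π such that density ratios are uniformly bounded by some v > 1 and such that Σ_{θ∈Θ} π(θ)^η < ∞ for some η ∈ (0,1). Then for every a' ∈ (0,1] there exist constants C₂, C₃ > 0 such that for all n ≥ 2, the Bayesian joint probability Π( Z^n : Δ_n(Z^n) ≥ C₂ · n^{a'} ) ≤ C₃ · (log n)² / n^{a'}. (Theorem 1, second part: a Bayesian a priori believes the cumulative mixability gap is small with high probability.) -/

import Mathlib

open MeasureTheory ENNReal

noncomputable section

/-- Unnormalized posterior weight of `θ` given the sample `z`. -/
def postNum {Z : Type*} {Θ : Type*} (π : Θ → ℝ) (f : Θ → Z → ℝ) {n : ℕ}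
    (z : Fin n → Z) (θ : Θ) : ℝ :=
  π θ * ∏ i, f θ (z i)

/-- The Bayesian posterior of `θ` given the sample `z`. -/
def post {Z : Type*} {Θ : Type*} (π : Θ → ℝ) (f : Θ → Z → ℝ) {n : ℕ}
    (z : Fin n → Z) (θ : Θ) : ℝ :=
  postNum π f z θ / ∑' θ', postNum π f z θ'

/-- The Bayes predictive density of a next outcome `x` given the sample `z`. -/
def pBayes {Z : Type*} {Θ : Type*} (π : Θ → ℝ) (f : Θ → Z → ℝ) {n : ℕ}
    (z : Fin n → Z) (x : Z) : ℝ :=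
  ∑' θ, post π f z θ * f θ x

/-- The prefix `z^{i}` = `(z_0, …, z_{i-1})` of the sample `z = z^n`. -/
def samplePrefix {Z : Type*} {n : ℕ} (z : Fin n → Z) (i : Fin n) : Fin (i : ℕ) → Z :=
  fun j => z ⟨j.1, j.2.trans i.2⟩

/-- The mixability gap `δ_{i+1}(z^{i+1})` incurred when predicting `z_i` from the
posterior based on the prefix `z^{i}`. -/
def mixGap {Z : Type*} {Θ : Type*} (π : Θ → ℝ) (f : Θ → Z → ℝ) {n : ℕ}
    (z : Fin n → Z) (i : Fin n) : ℝ :=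
  (∑' θ, post π f (samplePrefix z i) θ * (-Real.log (f θ (z i)))) +
    Real.log (pBayes π f (samplePrefix z i) (z i))

/-- The cumulative mixability gap `Δ_n(z^n) = Σ_{i=1}^n δ_i(z^i)`. -/
def cumGap {Z : Type*} {Θ : Type*} (π : Θ → ℝ) (f : Θ → Z → ℝ) {n : ℕ}
    (z : Fin n → Z) : ℝ :=
  ∑ i, mixGap π f z i

/-- The Bayesian joint probability `Π` of an event `E` (which may depend on the
sampled parameter `θ*`): `Σ_{θ*} π(θ*) · P_{θ*}^{⊗n}(E θ*)`, where `P_{θ*}^{⊗n}` is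
the product measure on `Z^n` with density `∏_i f_{θ*}(z_i)` w.r.t. `ρ^{⊗n}`. -/
def jointProb {Z : Type*} [MeasurableSpace Z] (ρ : Measure Z) [SigmaFinite ρ]
    {Θ : Type*} (π : Θ → ℝ) (f : Θ → Z → ℝ) (n : ℕ)
    (E : Θ → Set (Fin n → Z)) : ℝ≥0∞ :=
  ∑' θstar, ENNReal.ofReal (π θstar) *
    ((Measure.pi fun _ : Fin n => ρ).withDensity
      fun z => ENNReal.ofReal (∏ i, f θstar (z i))) (E θstar)

/-- Up to a constant depending on the range of `r`, the Bregman divergence of `-log` is bounded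
by that of `r ↦ r * log r`. -/
lemma sub_one_sub_log_le_mul_log {v r : ℝ} (hv : 1 < v) (hr : 1 / v ≤ r) (hrv : r ≤ v) :
    r - 1 - Real.log r ≤ 2 * v * (v + 1) * (r * Real.log r - r + 1) := by
  have hv0 : 0 < v := by linarith
  have hr0 : 0 < r := lt_of_lt_of_le (by positivity) hr
  have hvr : 1 ≤ v * r := by
    rw [div_le_iff₀ hv0] at hr
    linarith
  obtain ⟨s, hs0, rfl⟩ : ∃ s : ℝ, 0 < s ∧ r = s ^ 2 :=
    ⟨√r, Real.sqrt_pos.2 hr0, (Real.sq_sqrt hr0.le).symm⟩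
  have h1 : s ^ 2 - 1 - Real.log (s ^ 2) ≤ v * (s ^ 2 - 1) ^ 2 := by
    have h := Real.one_sub_inv_le_log_of_pos hr0
    have h2 : (s ^ 2)⁻¹ ≤ v := by
      rw [inv_le_iff_one_le_mul₀ hr0]
      exact hvr
    have h3 : s ^ 2 - 1 - (1 - (s ^ 2)⁻¹) = (s ^ 2)⁻¹ * (s ^ 2 - 1) ^ 2 := by
      field_simp
    have h4 := mul_le_mul_of_nonneg_right h2 (sq_nonneg (s ^ 2 - 1))
    linarith
  have h2 : (s - 1) ^ 2 ≤ s ^ 2 * Real.log (s ^ 2) - s ^ 2 + 1 := by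
    have h := Real.one_sub_inv_le_log_of_pos hs0
    have h3 : s ^ 2 * (1 - s⁻¹) = s ^ 2 - s := by
      field_simp
    have h4 := mul_le_mul_of_nonneg_left h (sq_nonneg s)
    rw [Real.log_pow]
    push_cast
    nlinarith
  have h3 : (s ^ 2 - 1) ^ 2 ≤ 2 * (v + 1) * (s - 1) ^ 2 := by
    have h4 : (s + 1) ^ 2 ≤ 2 * (v + 1) := by nlinarith [sq_nonneg (s - 1)]
    have h5 := mul_le_mul_of_nonneg_right h4 (sq_nonneg (s - 1))
    nlinarith
  calc s ^ 2 - 1 - Real.log (s ^ 2) ≤ v * (s ^ 2 - 1) ^ 2 := h1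
    _ ≤ v * (2 * (v + 1) * (s - 1) ^ 2) := by gcongr
    _ = 2 * v * (v + 1) * (s - 1) ^ 2 := by ring
    _ ≤ _ := by gcongr

/-- The unnormalized entropy of the weights `w`. -/
def weightEntropy {Θ : Type*} (w : Θ → ℝ) : ℝ :=
  ∑' θ, w θ * Real.log ((∑' θ', w θ') / w θ)

section OneStep

variable {Θ : Type*} {w g : Θ → ℝ} {v : ℝ}

lemma summable_mul_of_ratio_le (hw : ∀ θ, 0 < w θ) (hws : Summable w) (hg : ∀ θ, 0 < g θ)
    (hv : ∀ θ θ', g θ ≤ v * g θ') : Summable fun θ => w θ * g θ := by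
  rcases isEmpty_or_nonempty Θ with h | ⟨⟨θ₀⟩⟩
  · exact Summable.of_finite
  · refine Summable.of_nonneg_of_le (fun θ => (mul_pos (hw θ) (hg θ)).le)
      (fun θ => mul_le_mul_of_nonneg_left (hv θ θ₀) (hw θ).le) (hws.mul_right _)

lemma weight_log_nonneg (hw : ∀ θ, 0 < w θ) (hws : Summable w) (θ : Θ) :
    0 ≤ w θ * Real.log ((∑' θ', w θ') / w θ) := by
  refine mul_nonneg (hw θ).le (Real.log_nonneg ?_)
  rw [one_le_div (hw θ)]
  exact hws.le_tsum θ fun j _ => (hw j).le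

lemma weightEntropy_nonneg (hw : ∀ θ, 0 < w θ) (hws : Summable w) : 0 ≤ weightEntropy w :=
  tsum_nonneg fun θ => weight_log_nonneg hw hws θ

/-- The one-step inequality: the mixability gap is controlled by the expected drop of the
entropy of the posterior. -/
lemma mix_gap_add_entropy_le [Nonempty Θ] (hv1 : 1 < v) (hw : ∀ θ, 0 < w θ) (hws : Summable w)
    (hg : ∀ θ, 0 < g θ) (hv : ∀ θ θ', g θ ≤ v * g θ')
    (hent : Summable fun θ => w θ * Real.log ((∑' θ', w θ') / w θ)) {d : ℝ}
    (hd : d = (∑' θ, w θ / (∑' θ', w θ') * (-Real.log (g θ))) +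
      Real.log (∑' θ, w θ / (∑' θ', w θ') * g θ)) :
    (Summable fun θ => (w θ * g θ) * Real.log ((∑' θ', w θ' * g θ') / (w θ * g θ))) ∧
    0 ≤ d ∧
    (∑' θ, w θ * g θ) * d + 2 * v * (v + 1) * weightEntropy (fun θ => w θ * g θ) ≤
      2 * v * (v + 1) * ∑' θ, w θ * Real.log ((∑' θ', w θ') / w θ) * g θ := by
  have hv0 : 0 < v := by linarith
  obtain ⟨θ₀⟩ := ‹Nonempty Θ›
  have hwg := summable_mul_of_ratio_le hw hws hg hv
  have hentg : Summable fun θ => w θ * Real.log ((∑' θ', w θ') / w θ) * g θ :=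
    Summable.of_nonneg_of_le (fun θ => mul_nonneg (weight_log_nonneg hw hws θ) (hg θ).le)
      (fun θ => mul_le_mul_of_nonneg_left (hv θ θ₀) (weight_log_nonneg hw hws θ))
      (hent.mul_right _)
  unfold weightEntropy
  set W := ∑' θ, w θ with hW
  set S := ∑' θ, w θ * g θ with hS
  have hW0 : 0 < W := hws.tsum_pos (fun θ => (hw θ).le) θ₀ (hw θ₀)
  have hS0 : 0 < S :=
    hwg.tsum_pos (fun θ => (mul_pos (hw θ) (hg θ)).le) θ₀ (mul_pos (hw θ₀) (hg θ₀))
  have hSle : ∀ θ, S ≤ v * g θ * W := fun θ => by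
    rw [hS, hW, ← tsum_mul_left]
    refine hwg.tsum_le_tsum (fun θ' => ?_) (hws.mul_left _)
    rw [mul_comm (w θ')]
    exact mul_le_mul_of_nonneg_right (hv θ' θ) (hw θ').le
  have hleS : ∀ θ, g θ * W ≤ v * S := fun θ => by
    rw [hS, hW, ← tsum_mul_left, ← tsum_mul_left]
    refine (hws.mul_left _).tsum_le_tsum (fun θ' => ?_) (hwg.mul_left _)
    have := mul_le_mul_of_nonneg_right (hv θ θ') (hw θ').le
    linarith
  set r : Θ → ℝ := fun θ => g θ * W / S with hr
  have hr0 : ∀ θ, 0 < r θ := fun θ => div_pos (mul_pos (hg θ) hW0) hS0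
  have hrl : ∀ θ, 1 / v ≤ r θ := fun θ => by
    rw [hr, div_le_div_iff₀ hv0 hS0]
    linarith [hSle θ]
  have hru : ∀ θ, r θ ≤ v := fun θ => by
    rw [hr, div_le_iff₀ hS0]
    exact hleS θ
  have hlogabs : ∀ θ, |Real.log (r θ)| ≤ Real.log v := fun θ => by
    rw [abs_le]
    constructor
    · rw [← Real.log_inv, ← one_div]
      exact Real.log_le_log (by positivity) (hrl θ)
    · exact Real.log_le_log (hr0 θ) (hru θ)
  have hbdd : ∀ u : Θ → ℝ, (∀ θ, 0 < u θ) → Summable u →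
      Summable fun θ => u θ * Real.log (r θ) := fun u hu hus => by
    refine Summable.of_norm_bounded (hus.mul_right (Real.log v)) fun θ => ?_
    rw [Real.norm_eq_abs, abs_mul, abs_of_pos (hu θ)]
    exact mul_le_mul_of_nonneg_left (hlogabs θ) (hu θ).le
  have hwl := hbdd w hw hws
  have hwgl := hbdd _ (fun θ => mul_pos (hw θ) (hg θ)) hwg
  have hlogr : ∀ θ, Real.log (r θ) = Real.log (g θ) + Real.log W - Real.log S := fun θ => by
    rw [hr, Real.log_div (mul_pos (hg θ) hW0).ne' hS0.ne', Real.log_mul (hg θ).ne' hW0.ne']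
  have hsplit : ∀ θ, (w θ * g θ) * Real.log (S / (w θ * g θ)) =
      w θ * Real.log (W / w θ) * g θ - (w θ * g θ) * Real.log (r θ) := fun θ => by
    rw [hlogr, Real.log_div hS0.ne' (mul_pos (hw θ) (hg θ)).ne',
      Real.log_div hW0.ne' (hw θ).ne', Real.log_mul (hw θ).ne' (hg θ).ne']
    ring
  have hWd : W * d = -∑' θ, w θ * Real.log (r θ) := by
    have e1 : ∑' θ, w θ / W * g θ = S / W := by
      rw [hS, ← tsum_div_const]
      exact tsum_congr fun θ => by ring
    have e2 : ∑' θ, w θ / W * (-Real.log (g θ)) =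
        -(∑' θ, w θ * Real.log (r θ)) / W + (Real.log W - Real.log S) := by
      have : ∀ θ, w θ / W * (-Real.log (g θ)) =
          -(w θ * Real.log (r θ)) / W + w θ * ((Real.log W - Real.log S) / W) := fun θ => by
        rw [hlogr]
        field_simp
        ring
      simp_rw [this]
      rw [(hwl.neg.div_const W).tsum_add (hws.mul_right _), tsum_div_const, tsum_neg,
        tsum_mul_right, ← hW]
      field_simp
    rw [hd, e1, e2, Real.log_div hS0.ne' hW0.ne']
    field_simp
    ring
  have hwr : ∀ θ, w θ * r θ = w θ * g θ * (W / S) := fun θ => by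
    rw [hr]
    ring
  have hswr : Summable fun θ => w θ * r θ := by
    simp_rw [hwr]
    exact hwg.mul_right _
  have htwr : ∑' θ, w θ * r θ = W := by
    simp_rw [hwr]
    rw [tsum_mul_right, ← hS]
    field_simp
  have hWd' : W * d = ∑' θ, w θ * (r θ - 1 - Real.log (r θ)) := by
    have : ∀ θ, w θ * (r θ - 1 - Real.log (r θ)) =
        w θ * r θ - w θ - w θ * Real.log (r θ) := fun θ => by ring
    simp_rw [this]
    rw [(hswr.sub hws).tsum_sub hwl, hswr.tsum_sub hws, htwr, hWd, ← hW]
    ring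
  have hd0 : 0 ≤ d := by
    refine nonneg_of_mul_nonneg_right ?_ hW0
    rw [hWd']
    exact tsum_nonneg fun θ => mul_nonneg (hw θ).le
      (by linarith [Real.log_le_sub_one_of_pos (hr0 θ)])
  have hbound : S * d ≤ 2 * v * (v + 1) * ∑' θ, (w θ * g θ) * Real.log (r θ) := by
    have hs2 : Summable fun θ => w θ * r θ * Real.log (r θ) := by
      have := hwgl.mul_right (W / S)
      refine this.congr fun θ => ?_
      rw [hwr]
      ring
    have h1 : W * d ≤ 2 * v * (v + 1) * ∑' θ, w θ * r θ * Real.log (r θ) := by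
      have e : ∑' θ, w θ * r θ * Real.log (r θ) =
          ∑' θ, (w θ * r θ * Real.log (r θ) - w θ * r θ + w θ) := by
        rw [(hs2.sub hswr).tsum_add hws, hs2.tsum_sub hswr, htwr, ← hW]
        ring
      rw [hWd', e, ← tsum_mul_left]
      refine Summable.tsum_le_tsum (fun θ => ?_) ?_ (((hs2.sub hswr).add hws).mul_left _)
      · have := mul_le_mul_of_nonneg_left
          (sub_one_sub_log_le_mul_log hv1 (hrl θ) (hru θ)) (hw θ).le
        linarith
      · refine ((hswr.sub hws).sub hwl).congr fun θ => ?_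
        ring
    have e2 : ∑' θ, w θ * r θ * Real.log (r θ) =
        (∑' θ, (w θ * g θ) * Real.log (r θ)) * (W / S) := by
      rw [← tsum_mul_right]
      refine tsum_congr fun θ => ?_
      rw [hwr]
      ring
    rw [e2] at h1
    have h2 := mul_le_mul_of_nonneg_right h1 (div_pos hS0 hW0).le
    calc S * d = W * d * (S / W) := by field_simp
      _ ≤ _ := h2
      _ = _ := by field_simp
  refine ⟨?_, hd0, ?_⟩
  · simp_rw [hsplit]
    exact hentg.sub hwgl
  · simp_rw [hsplit]
    rw [hentg.tsum_sub hwgl]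
    linarith

end OneStep

section Sample

variable {Z Θ : Type*}

lemma postNum_cons (w : Θ → ℝ) (f : Θ → Z → ℝ) {n : ℕ} (x : Z) (z : Fin n → Z) :
    postNum w f (Fin.cons x z : Fin (n + 1) → Z) = postNum (fun θ => w θ * f θ x) f z := by
  funext θ
  simp [postNum, Fin.prod_univ_succ, mul_assoc]

lemma samplePrefix_cons_succ {n : ℕ} (x : Z) (z : Fin n → Z) (i : Fin n) :
    samplePrefix (Fin.cons x z : Fin (n + 1) → Z) i.succ =
      (Fin.cons x (samplePrefix z i) : Fin ((i : ℕ) + 1) → Z) := by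
  funext j
  refine Fin.cases ?_ (fun k => ?_) j
  · rfl
  · rfl

lemma mixGap_cons_succ (w : Θ → ℝ) (f : Θ → Z → ℝ) {n : ℕ} (x : Z) (z : Fin n → Z) (i : Fin n) :
    mixGap w f (Fin.cons x z : Fin (n + 1) → Z) i.succ = mixGap (fun θ => w θ * f θ x) f z i := by
  have h : ∀ θ, post w f (samplePrefix (Fin.cons x z : Fin (n + 1) → Z) i.succ) θ =
      post (fun θ => w θ * f θ x) f (samplePrefix z i) θ := fun θ => by
    rw [samplePrefix_cons_succ]
    change post w f (Fin.cons x (samplePrefix z i) : Fin ((i : ℕ) + 1) → Z) θ = _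
    simp only [post, postNum_cons]
  simp only [mixGap, pBayes, h, Fin.cons_succ]

lemma mixGap_cons_zero (w : Θ → ℝ) (f : Θ → Z → ℝ) {n : ℕ} (x : Z) (z : Fin n → Z) :
    mixGap w f (Fin.cons x z : Fin (n + 1) → Z) 0 =
      (∑' θ, w θ / (∑' θ', w θ') * (-Real.log (f θ x))) +
        Real.log (∑' θ, w θ / (∑' θ', w θ') * f θ x) := by
  have h : ∀ y : Fin 0 → Z, ∀ θ, post w f y θ = w θ / ∑' θ', w θ' := fun y θ => by
    simp [post, postNum]
  have h' : ∀ θ, post w f (samplePrefix (Fin.cons x z : Fin (n + 1) → Z) 0) θ =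
      w θ / ∑' θ', w θ' := fun θ => h _ θ
  simp only [mixGap, pBayes, h', Fin.cons_zero]

lemma cumGap_cons (w : Θ → ℝ) (f : Θ → Z → ℝ) {n : ℕ} (x : Z) (z : Fin n → Z) :
    cumGap w f (Fin.cons x z : Fin (n + 1) → Z) =
      (∑' θ, w θ / (∑' θ', w θ') * (-Real.log (f θ x))) +
        Real.log (∑' θ, w θ / (∑' θ', w θ') * f θ x) +
      cumGap (fun θ => w θ * f θ x) f z := by
  rw [cumGap, Fin.sum_univ_succ, mixGap_cons_zero]
  simp only [mixGap_cons_succ, cumGap]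

variable [MeasurableSpace Z]

lemma measurable_postNum {f : Θ → Z → ℝ} (hf : ∀ θ, Measurable (f θ)) (w : Θ → ℝ) (n : ℕ) (θ : Θ) :
    Measurable fun z : Fin n → Z => postNum w f z θ := by
  unfold postNum
  exact measurable_const.mul
    (Finset.measurable_prod _ fun i _ => (hf θ).comp (measurable_pi_apply i))

lemma measurable_cumGap [Countable Θ] {f : Θ → Z → ℝ} (hf : ∀ θ, Measurable (f θ)) (w : Θ → ℝ)
    (n : ℕ) : Measurable fun z : Fin n → Z => cumGap w f z := by
  unfold cumGap
  refine Finset.measurable_sum _ fun i _ => ?_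
  have hp : Measurable fun z : Fin n → Z => samplePrefix z i :=
    measurable_pi_iff.2 fun j => measurable_pi_apply _
  have hpost : ∀ θ, Measurable fun z : Fin n → Z => post w f (samplePrefix z i) θ := fun θ =>
    ((measurable_postNum hf w _ θ).comp hp).div
      (Measurable.tsum fun θ' => (measurable_postNum hf w _ θ').comp hp)
  have hfi : ∀ θ, Measurable fun z : Fin n → Z => f θ (z i) := fun θ =>
    (hf θ).comp (measurable_pi_apply i)
  unfold mixGap pBayes
  exact (Measurable.tsum fun θ => (hpost θ).mul (hfi θ).log.neg).add
    (Measurable.tsum fun θ => (hpost θ).mul (hfi θ)).log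

lemma lintegral_pi_succ_le (ρ : Measure Z) [SigmaFinite ρ] (n : ℕ)
    (F : (Fin (n + 1) → Z) → ℝ≥0∞) :
    ∫⁻ z, F z ∂(Measure.pi fun _ : Fin (n + 1) => ρ) ≤
      ∫⁻ x, ∫⁻ z, F (Fin.cons x z) ∂(Measure.pi fun _ : Fin n => ρ) ∂ρ := by
  have h := (measurePreserving_piFinSuccAbove (fun _ : Fin (n + 1) => ρ) 0).symm
  rw [← h.lintegral_comp_emb (MeasurableEquiv.measurableEmbedding _)]
  refine (lintegral_prod_le _).trans (le_of_eq ?_)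
  refine lintegral_congr fun x => lintegral_congr fun z => ?_
  congr 1
  exact Fin.insertNth_zero' x z

lemma lintegral_prod_density_le_one (ρ : Measure Z) [SigmaFinite ρ] {g : Z → ℝ}
    (hg0 : ∀ x, 0 ≤ g x) (hg : ∫⁻ x, ENNReal.ofReal (g x) ∂ρ = 1) (n : ℕ) :
    ∫⁻ z, ENNReal.ofReal (∏ i, g (z i)) ∂(Measure.pi fun _ : Fin n => ρ) ≤ 1 := by
  induction n with
  | zero => simp
  | succ n ih =>
    refine (lintegral_pi_succ_le ρ n _).trans ?_
    calc _ = ∫⁻ x, ENNReal.ofReal (g x) *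
          ∫⁻ z, ENNReal.ofReal (∏ i, g (z i)) ∂(Measure.pi fun _ : Fin n => ρ) ∂ρ := by
          refine lintegral_congr fun x => ?_
          rw [← lintegral_const_mul' _ _ ENNReal.ofReal_ne_top]
          refine lintegral_congr fun z => ?_
          rw [Fin.prod_univ_succ, ENNReal.ofReal_mul (hg0 _)]
          simp
      _ ≤ ∫⁻ x, ENNReal.ofReal (g x) * 1 ∂ρ := by gcongr
      _ = 1 := by simpa using hg

/-- The unnormalized Bayesian marginal density of a sample. -/
def marginalDensity (w : Θ → ℝ) (f : Θ → Z → ℝ) {n : ℕ} (z : Fin n → Z) : ℝ≥0∞ :=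
  ∑' θ, ENNReal.ofReal (postNum w f z θ)

lemma measurable_marginalDensity [Countable Θ] {f : Θ → Z → ℝ} (hf : ∀ θ, Measurable (f θ))
    (w : Θ → ℝ) (n : ℕ) : Measurable fun z : Fin n → Z => marginalDensity w f z :=
  Measurable.tsum fun θ => (measurable_postNum hf w n θ).ennreal_ofReal

lemma lintegral_marginalDensity_le [Countable Θ] (ρ : Measure Z) [SigmaFinite ρ] {f : Θ → Z → ℝ}
    (hf : ∀ θ, Measurable (f θ)) (hf0 : ∀ θ x, 0 < f θ x)
    (hf1 : ∀ θ, ∫⁻ x, ENNReal.ofReal (f θ x) ∂ρ = 1) {w : Θ → ℝ} (hw : ∀ θ, 0 < w θ)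
    (hws : Summable w) (n : ℕ) :
    ∫⁻ z, marginalDensity w f z ∂(Measure.pi fun _ : Fin n => ρ) ≤
      ENNReal.ofReal (∑' θ, w θ) := by
  unfold marginalDensity
  rw [lintegral_tsum fun θ => (measurable_postNum hf w n θ).ennreal_ofReal.aemeasurable,
    ENNReal.ofReal_tsum_of_nonneg (fun θ => (hw θ).le) hws]
  refine ENNReal.tsum_le_tsum fun θ => ?_
  simp_rw [postNum, ENNReal.ofReal_mul (hw θ).le]
  rw [lintegral_const_mul' _ _ ENNReal.ofReal_ne_top]
  exact mul_le_of_le_one_right' (lintegral_prod_density_le_one ρ (fun x => (hf0 θ x).le) (hf1 θ) n)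

/-- The Bayesian expectation of the cumulative mixability gap is bounded by a multiple of the
entropy of the prior. -/
lemma lintegral_cumGap_le [Countable Θ] [Nonempty Θ] (ρ : Measure Z) [SigmaFinite ρ]
    {f : Θ → Z → ℝ} (hf : ∀ θ, Measurable (f θ)) (hf0 : ∀ θ x, 0 < f θ x)
    (hf1 : ∀ θ, ∫⁻ x, ENNReal.ofReal (f θ x) ∂ρ = 1) {v : ℝ} (hv : 1 < v)
    (hratio : ∀ (x : Z) (θ θ' : Θ), f θ x ≤ v * f θ' x) (n : ℕ) {w : Θ → ℝ} (hw : ∀ θ, 0 < w θ)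
    (hws : Summable w) (hent : Summable fun θ => w θ * Real.log ((∑' θ', w θ') / w θ)) :
    ∫⁻ z, marginalDensity w f z * ENNReal.ofReal (cumGap w f z)
        ∂(Measure.pi fun _ : Fin n => ρ) ≤
      ENNReal.ofReal (2 * v * (v + 1) * weightEntropy w) := by
  have hv0 : 0 < v := by linarith
  have hC : 0 ≤ 2 * v * (v + 1) := by positivity
  induction n generalizing w with
  | zero => simp [cumGap]
  | succ n ih =>
    refine (lintegral_pi_succ_le ρ n _).trans ?_
    have hentg : ∀ x, Summable fun θ => w θ * Real.log ((∑' θ', w θ') / w θ) * f θ x := fun x => by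
      obtain ⟨θ₀⟩ := ‹Nonempty Θ›
      exact Summable.of_nonneg_of_le
        (fun θ => mul_nonneg (weight_log_nonneg hw hws θ) (hf0 θ x).le)
        (fun θ => mul_le_mul_of_nonneg_left (hratio x θ θ₀) (weight_log_nonneg hw hws θ))
        (hent.mul_right _)
    calc _ ≤ ∫⁻ x, ENNReal.ofReal (2 * v * (v + 1)) *
          ∑' θ, ENNReal.ofReal (w θ * Real.log ((∑' θ', w θ') / w θ)) *
            ENNReal.ofReal (f θ x) ∂ρ := by
          refine lintegral_mono fun x => ?_
          obtain ⟨d, hd⟩ : ∃ d, d = (∑' θ, w θ / (∑' θ', w θ') * (-Real.log (f θ x))) +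
            Real.log (∑' θ, w θ / (∑' θ', w θ') * f θ x) := ⟨_, rfl⟩
          obtain ⟨hs, hd0, hle⟩ := mix_gap_add_entropy_le hv hw hws (fun θ => hf0 θ x)
            (hratio x) hent hd
          have hw' : ∀ θ, 0 < w θ * f θ x := fun θ => mul_pos (hw θ) (hf0 θ x)
          have hws' := summable_mul_of_ratio_le hw hws (fun θ => hf0 θ x) (hratio x)
          have hS0 : 0 ≤ ∑' θ, w θ * f θ x := tsum_nonneg fun θ => (hw' θ).le
          calc _ ≤ ∫⁻ z, (marginalDensity (fun θ => w θ * f θ x) f z * ENNReal.ofReal d +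
                marginalDensity (fun θ => w θ * f θ x) f z *
                  ENNReal.ofReal (cumGap (fun θ => w θ * f θ x) f z))
                  ∂(Measure.pi fun _ : Fin n => ρ) := by
                refine lintegral_mono fun z => ?_
                rw [cumGap_cons, ← hd, marginalDensity, postNum_cons, ← mul_add]
                exact mul_le_mul_right ENNReal.ofReal_add_le _
            _ = (∫⁻ z, marginalDensity (fun θ => w θ * f θ x) f z
                  ∂(Measure.pi fun _ : Fin n => ρ)) * ENNReal.ofReal d + _ := by
                rw [lintegral_add_left ((measurable_marginalDensity hf _ n).mul_const _),
                  lintegral_mul_const' _ _ ENNReal.ofReal_ne_top]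
            _ ≤ ENNReal.ofReal (∑' θ, w θ * f θ x) * ENNReal.ofReal d +
                ENNReal.ofReal (2 * v * (v + 1) * weightEntropy fun θ => w θ * f θ x) :=
                add_le_add
                  (mul_le_mul_left (lintegral_marginalDensity_le ρ hf hf0 hf1 hw' hws' n) _)
                  (ih hw' hws' hs)
            _ ≤ ENNReal.ofReal (2 * v * (v + 1) *
                ∑' θ, w θ * Real.log ((∑' θ', w θ') / w θ) * f θ x) := by
                rw [← ENNReal.ofReal_mul hS0, ← ENNReal.ofReal_add (mul_nonneg hS0 hd0)
                  (mul_nonneg hC (weightEntropy_nonneg hw' hws'))]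
                exact ENNReal.ofReal_le_ofReal hle
            _ = _ := by
                rw [ENNReal.ofReal_mul hC, ENNReal.ofReal_tsum_of_nonneg
                  (fun θ => mul_nonneg (weight_log_nonneg hw hws θ) (hf0 θ x).le) (hentg x)]
                simp_rw [ENNReal.ofReal_mul (weight_log_nonneg hw hws _)]
      _ = ENNReal.ofReal (2 * v * (v + 1) * weightEntropy w) := by
          rw [lintegral_const_mul' _ _ ENNReal.ofReal_ne_top, lintegral_tsum fun θ =>
            ((hf θ).ennreal_ofReal.const_mul _).aemeasurable]
          simp_rw [lintegral_const_mul' _ _ ENNReal.ofReal_ne_top, hf1, mul_one]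
          rw [ENNReal.ofReal_mul hC, weightEntropy,
            ENNReal.ofReal_tsum_of_nonneg (weight_log_nonneg hw hws) hent]

lemma jointProb_eq_setLIntegral [Countable Θ] (ρ : Measure Z) [SigmaFinite ρ] {f : Θ → Z → ℝ}
    (hf : ∀ θ, Measurable (f θ)) {w : Θ → ℝ} (hw : ∀ θ, 0 < w θ) {n : ℕ} {E : Set (Fin n → Z)}
    (hE : MeasurableSet E) :
    jointProb ρ w f n (fun _ => E) =
      ∫⁻ z in E, marginalDensity w f z ∂(Measure.pi fun _ : Fin n => ρ) := by
  unfold marginalDensity jointProb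
  rw [lintegral_tsum fun θ => (measurable_postNum hf w n θ).ennreal_ofReal.aemeasurable]
  refine tsum_congr fun θ => ?_
  rw [withDensity_apply _ hE, ← lintegral_const_mul' _ _ ENNReal.ofReal_ne_top]
  simp_rw [postNum, ENNReal.ofReal_mul (hw θ).le]

lemma mul_jointProb_le_lintegral [Countable Θ] (ρ : Measure Z) [SigmaFinite ρ] {f : Θ → Z → ℝ}
    (hf : ∀ θ, Measurable (f θ)) {w : Θ → ℝ} (hw : ∀ θ, 0 < w θ) {n : ℕ} (c : ℝ) :
    ENNReal.ofReal c * jointProb ρ w f n (fun _ => {z | c ≤ cumGap w f z}) ≤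
      ∫⁻ z, marginalDensity w f z * ENNReal.ofReal (cumGap w f z)
        ∂(Measure.pi fun _ : Fin n => ρ) := by
  have hE : MeasurableSet {z : Fin n → Z | c ≤ cumGap w f z} :=
    measurableSet_le measurable_const (measurable_cumGap hf w n)
  rw [jointProb_eq_setLIntegral ρ hf hw hE, ← lintegral_const_mul' _ _ ENNReal.ofReal_ne_top]
  refine le_trans (setLIntegral_mono' hE fun z hz => ?_) (setLIntegral_le_lintegral _ _)
  rw [mul_comm]
  exact mul_le_mul_right (ENNReal.ofReal_le_ofReal hz) _

end Sample

lemma summable_mul_log_inv_of_summable_rpow {Θ : Type*} {w : Θ → ℝ} (hw : ∀ θ, 0 < w θ)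
    (hw1 : ∀ θ, w θ ≤ 1) {η : ℝ} (hη : η < 1) (hs : Summable fun θ => w θ ^ η) :
    Summable fun θ => w θ * Real.log (1 / w θ) := by
  have hη' : 0 < 1 - η := by linarith
  refine Summable.of_nonneg_of_le (fun θ => ?_) (fun θ => ?_) (hs.div_const (1 - η))
  · exact mul_nonneg (hw θ).le (Real.log_nonneg ((one_le_div (hw θ)).2 (hw1 θ)))
  · have h := Real.log_le_rpow_div (one_div_pos.2 (hw θ)).le hη'
    calc w θ * Real.log (1 / w θ) ≤ w θ * ((1 / w θ) ^ (1 - η) / (1 - η)) :=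
          mul_le_mul_of_nonneg_left h (hw θ).le
      _ = w θ ^ η / (1 - η) := by
          rw [one_div, Real.inv_rpow (hw θ).le, ← Real.rpow_neg (hw θ).le, ← mul_div_assoc]
          congr 1
          nth_rewrite 1 [← Real.rpow_one (w θ)]
          rw [← Real.rpow_add (hw θ)]
          congr 1
          ring

/-- Theorem 1, second part: a Bayesian a priori believes the cumulative mixability
gap is small with high probability: for every `a' ∈ (0,1]` there are `C₂, C₃ > 0`
such that for all `n ≥ 2`, `Π( Z^n : Δ_n(Z^n) ≥ C₂ n^{a'} ) ≤ C₃ (log n)² / n^{a'}`. -/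
theorem bayesian_belief_in_concentration_cumulative_gap
    {Z : Type*} [MeasurableSpace Z] (ρ : Measure Z) [SigmaFinite ρ]
    {Θ : Type*} [Countable Θ]
    (f : Θ → Z → ℝ) (hf_meas : ∀ θ, Measurable (f θ))
    (hf_pos : ∀ θ x, 0 < f θ x)
    (hf_int : ∀ θ, ∫ x, f θ x ∂ρ = 1)
    (π : Θ → ℝ) (hπ_pos : ∀ θ, 0 < π θ) (hπ_sum : ∑' θ, π θ = 1)
    (v : ℝ) (hv : 1 < v)
    (hratio : ∀ (x : Z) (θ θ' : Θ), f θ x ≤ v * f θ' x)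
    (η : ℝ) (hη : η ∈ Set.Ioo (0 : ℝ) 1)
    (hsum : Summable fun θ => π θ ^ η) :
    ∀ a' : ℝ, 0 < a' → a' ≤ 1 → ∃ C₂ C₃ : ℝ, 0 < C₂ ∧ 0 < C₃ ∧ ∀ n : ℕ, 2 ≤ n →
      jointProb ρ π f n
          (fun _ => {z | C₂ * (n : ℝ) ^ a' ≤ cumGap π f z})
        ≤ ENNReal.ofReal (C₃ * (Real.log n) ^ 2 / (n : ℝ) ^ a') := by
  intro a' ha' _
  have hv0 : 0 < v := by linarith
  have hπs : Summable π := by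
    by_contra h
    rw [tsum_eq_zero_of_not_summable h] at hπ_sum
    exact zero_ne_one hπ_sum
  have hne : Nonempty Θ := by
    by_contra h
    rw [not_nonempty_iff] at h
    rw [tsum_empty] at hπ_sum
    exact zero_ne_one hπ_sum
  have hf1 : ∀ θ, ∫⁻ x, ENNReal.ofReal (f θ x) ∂ρ = 1 := fun θ => by
    have hi : Integrable (f θ) ρ := by
      by_contra h
      have := hf_int θ
      rw [integral_undef h] at this
      exact zero_ne_one this
    rw [← ofReal_integral_eq_lintegral_ofReal hi (ae_of_all _ fun x => (hf_pos θ x).le), hf_int θ,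
      ENNReal.ofReal_one]
  have hπ1 : ∀ θ, π θ ≤ 1 := fun θ => by
    rw [← hπ_sum]
    exact hπs.le_tsum θ fun j _ => (hπ_pos j).le
  have hent : Summable fun θ => π θ * Real.log ((∑' θ', π θ') / π θ) := by
    rw [hπ_sum]
    exact summable_mul_log_inv_of_summable_rpow hπ_pos hπ1 hη.2 hsum
  set K := 2 * v * (v + 1) * weightEntropy π with hK
  have hK0 : 0 ≤ K := mul_nonneg (by positivity) (weightEntropy_nonneg hπ_pos hπs)
  have hlog2 : 0 < Real.log 2 := Real.log_pos (by norm_num)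
  refine ⟨1, (K + 1) / Real.log 2 ^ 2, one_pos, by positivity, fun n hn => ?_⟩
  have hn0 : (0 : ℝ) < n := by
    have : 0 < n := by omega
    exact_mod_cast this
  have hna : 0 < (n : ℝ) ^ a' := Real.rpow_pos_of_pos hn0 a'
  rw [one_mul]
  have h := (mul_jointProb_le_lintegral ρ hf_meas hπ_pos ((n : ℝ) ^ a')).trans
    (lintegral_cumGap_le ρ hf_meas hf_pos hf1 hv hratio n hπ_pos hπs hent)
  rw [mul_comm] at h
  have h2 := (ENNReal.le_div_iff_mul_le (Or.inl (by simpa using hna))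
    (Or.inl ENNReal.ofReal_ne_top)).2 h
  refine h2.trans ?_
  rw [← ENNReal.ofReal_div_of_pos hna]
  refine ENNReal.ofReal_le_ofReal (div_le_div_of_nonneg_right ?_ hna.le)
  have hlog : Real.log 2 ≤ Real.log n :=
    Real.log_le_log (by norm_num) (by exact_mod_cast hn)
  have hsq : Real.log 2 ^ 2 ≤ Real.log n ^ 2 := pow_le_pow_left₀ hlog2.le hlog 2
  rw [← hK, div_mul_eq_mul_div, le_div_iff₀ (by positivity)]
  calc K * Real.log 2 ^ 2 ≤ (K + 1) * Real.log 2 ^ 2 := by nlinarith [sq_nonneg (Real.log 2)]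
    _ ≤ (K + 1) * Real.log n ^ 2 := by gcongr
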